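/- arXiv:1205.2066 — 2 statements merged into one kernel-verified Lean document; each statement's English description precedes it below -/
import Mathlib

section
/- For any k, k' ∈ I, a ∈ ℤ and c ∈ ℤ + 1/2, the value (C_q^{-1} e_{k,a})(k', c) equals ⟨Φ^{c−1/2}[P̄_{k'}], Φ^{a}[P̄_k]⟩ if c ≥ a + 1/2, and equals 0 if c < a + 1/2. (Here Φ^{c−1/2} and Φ^a are integer powers of the invertible Coxeter matrix; this expresses the entries of C_q^{-1} through Euler pairings of τ-shifted indecomposable projectives.) -/
namespace GQV

open Matrix

/-- Degree shift `η[d]`, i.e. `η[d]ᵢ(a) = ηᵢ(a + d)`. -/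
noncomputable def shift {n : ℕ} (η : Fin n × ℝ → ℤ) (d : ℝ) : Fin n × ℝ → ℤ :=
  fun p => η (p.1, p.2 + d)

/-- The q-Cartan operator `C_q`. -/
noncomputable def Cq {n : ℕ} (b : Matrix (Fin n) (Fin n) ℤ) (η : Fin n × ℝ → ℤ) : Fin n × ℝ → ℤ :=
  fun p =>
    η (p.1, p.2 + 1 / 2) + η (p.1, p.2 - 1 / 2)
      - ∑ i : Fin n, (if i < p.1 then b i p.1 * η (i, p.2 + 1 / 2) else 0)
      - ∑ j : Fin n, (if p.1 < j then b p.1 j * η (j, p.2 - 1 / 2) else 0)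

/-- The pairing `η¹ · η² = Σ_{(i,a)} η¹ᵢ(a) η²ᵢ(a)`. -/
noncomputable def dotP {n : ℕ} (η₁ η₂ : Fin n × ℝ → ℤ) : ℤ := ∑ᶠ p, η₁ p * η₂ p

/-- The indicator function `e_{k,a}` of `(k,a)`. -/
noncomputable def eind {n : ℕ} (k : Fin n) (a : ℝ) : Fin n × ℝ → ℤ := fun p => if p = (k, a) then 1 else 0

/-- Support contained in `I × ℤ`. -/
def SuppInt {n : ℕ} (η : Fin n × ℝ → ℤ) : Prop := ∀ p, η p ≠ 0 → ∃ m : ℤ, p.2 = (m : ℝ)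

/-- Support contained in `I × (ℤ + 1/2)`. -/
def SuppHalfInt {n : ℕ} (η : Fin n × ℝ → ℤ) : Prop :=
  ∀ p, η p ≠ 0 → ∃ m : ℤ, p.2 = (m : ℝ) + 1 / 2

/-- The set `E`: functions supported on integer arguments, vanishing for all
sufficiently small arguments. -/
def memE {n : ℕ} (η : Fin n × ℝ → ℤ) : Prop :=
  SuppInt η ∧ ∃ N : ℤ, ∀ (k : Fin n) (a : ℝ), a < (N : ℝ) → η (k, a) = 0

/-- The set `E[d] = {η[d] : η ∈ E}`. -/
def memEshift {n : ℕ} (d : ℝ) (η : Fin n × ℝ → ℤ) : Prop :=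
  ∃ θ, memE θ ∧ η = shift θ d

/-- Functions on `I × (ℤ + 1/2)` vanishing for all sufficiently small arguments;
this is the set `E[1/2] = E[-1/2]`. -/
def memEhalf {n : ℕ} (η : Fin n × ℝ → ℤ) : Prop :=
  SuppHalfInt η ∧ ∃ N : ℤ, ∀ (k : Fin n) (a : ℝ), a < (N : ℝ) → η (k, a) = 0

/-- The strictly upper triangular part `b^>`. -/
def bUpper {n : ℕ} (b : Matrix (Fin n) (Fin n) ℤ) : Matrix (Fin n) (Fin n) ℤ :=
  Matrix.of fun i j => if i < j then b i j else 0

/-- `E_Q = 1 - b^>`, the matrix of the Euler form. -/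
def EQmat {n : ℕ} (b : Matrix (Fin n) (Fin n) ℤ) : Matrix (Fin n) (Fin n) ℤ := 1 - bUpper b

/-- The Euler form `⟨x, y⟩ = xᵀ E_Q y`. -/
def euler {n : ℕ} (b : Matrix (Fin n) (Fin n) ℤ) (x y : Fin n → ℤ) : ℤ :=
  x ⬝ᵥ (EQmat b *ᵥ y)

/-- The class `[Ī_i] = E_Q⁻¹ e_i` of the indecomposable injective with socle `S_i`. -/
noncomputable def Iinj {n : ℕ} (b : Matrix (Fin n) (Fin n) ℤ) (i : Fin n) : Fin n → ℤ :=
  (EQmat b)⁻¹ *ᵥ Pi.single i 1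

/-- The class `[P̄_i] = E_Q⁻ᵀ e_i` of the indecomposable projective with top `S_i`. -/
noncomputable def Pproj {n : ℕ} (b : Matrix (Fin n) (Fin n) ℤ) (i : Fin n) : Fin n → ℤ :=
  ((EQmat b)ᵀ)⁻¹ *ᵥ Pi.single i 1

/-- The Coxeter matrix `Φ = -E_Q⁻¹ E_Qᵀ`. -/
noncomputable def Cox {n : ℕ} (b : Matrix (Fin n) (Fin n) ℤ) : Matrix (Fin n) (Fin n) ℤ :=
  -((EQmat b)⁻¹ * (EQmat b)ᵀ)

/-- The map `β`, defined `ℤ`-linearly by `β(e_{i,a}) = -Φ^a [Ī_i]` for `a ∈ ℤ`. -/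
noncomputable def betaMap {n : ℕ} (b : Matrix (Fin n) (Fin n) ℤ) (η : Fin n × ℝ → ℤ) :
    Fin n → ℤ :=
  ∑ᶠ p : Fin n × ℤ, η (p.1, (p.2 : ℝ)) • ((-(Cox b ^ p.2)) *ᵥ Iinj b p.1)

/-- `𝒩(w¹,w²) = w¹[1/2]·C_q⁻¹w² − w¹[−1/2]·C_q⁻¹w² − w²[1/2]·C_q⁻¹w¹ + w²[−1/2]·C_q⁻¹w¹`,
where `u₁ = C_q⁻¹ w¹`, `u₂ = C_q⁻¹ w²` are given as arguments. -/
noncomputable def Ncal {n : ℕ} (w₁ w₂ u₁ u₂ : Fin n × ℝ → ℤ) : ℤ :=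
  dotP (shift w₁ (1 / 2)) u₂ - dotP (shift w₁ (-(1 / 2))) u₂
    - dotP (shift w₂ (1 / 2)) u₁ + dotP (shift w₂ (-(1 / 2))) u₁

/-- `ℰ'(w¹,w²) = −w¹[1/2]·C_q⁻¹w² + w²[1/2]·C_q⁻¹w¹`, where `u₁ = C_q⁻¹ w¹`,
`u₂ = C_q⁻¹ w²` are given as arguments. -/
noncomputable def Ecal {n : ℕ} (w₁ w₂ u₁ u₂ : Fin n × ℝ → ℤ) : ℤ :=
  -dotP (shift w₁ (1 / 2)) u₂ + dotP (shift w₂ (1 / 2)) u₁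

/-- The B-matrix of the level-1 ice quiver with z-pattern attached to `Q`. -/
def Btilde {n : ℕ} (b : Matrix (Fin n) (Fin n) ℤ) : Matrix (Fin n ⊕ Fin n) (Fin n) ℤ :=
  Matrix.of (Sum.elim (fun i k => b i k)
    (fun j k => -(if j = k then 1 else 0) + (if k < j then b k j else 0)))

/-- The index map: the `ℤ`-linear map on functions supported on `I × {-1, 0}`
with `ind(e_{k,0}) = e_k` and `ind(e_{k,-1}) = e_{n+k} - e_k`. -/
noncomputable def indMap {n : ℕ} (w : Fin n × ℝ → ℤ) : Fin n ⊕ Fin n → ℤ :=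
  Sum.elim (fun k => w (k, 0) - w (k, -1)) (fun k => w (k, -1))

end GQV


open Matrix GQV

theorem aux_det {n : ℕ} (b : Matrix (Fin n) (Fin n) ℤ) : (EQmat b).det = 1 := by
  rw [Matrix.det_of_isUpperTriangular]
  · simp [EQmat, bUpper]
  · intro i j hij
    have hij' : j < i := hij
    simp [EQmat, bUpper, hij'.ne', not_lt.mpr hij'.le]

theorem aux_rec {n : ℕ} (b : Matrix (Fin n) (Fin n) ℤ) (k : Fin n) (a : ℤ) (θ : Fin n × ℝ → ℤ)
    (hCq : GQV.Cq b θ = GQV.eind k (a : ℝ)) (p : ℤ) :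
    (EQmat b)ᵀ *ᵥ (fun i => θ (i, (p : ℝ) + 1 / 2))
      + EQmat b *ᵥ (fun i => θ (i, ((p - 1 : ℤ) : ℝ) + 1 / 2))
      = if p = a then Pi.single k 1 else 0 := by
  ext i
  have h := congrFun hCq (i, (p : ℝ))
  have e : ((p - 1 : ℤ) : ℝ) + 1 / 2 = (p : ℝ) - 1 / 2 := by push_cast; ring
  rw [e]
  have hr : (if p = a then Pi.single k 1 else 0 : Fin n → ℤ) i = eind k (a : ℝ) (i, (p : ℝ)) := by
    by_cases hp : p = a <;> by_cases hi : i = k <;> simp [eind, hp, hi]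
  rw [hr, ← h]
  simp only [Cq, EQmat, Matrix.transpose_sub, Matrix.transpose_one, Matrix.sub_mulVec,
    Matrix.one_mulVec, Pi.add_apply, Pi.sub_apply]
  simp only [Matrix.mulVec, dotProduct, bUpper, Matrix.transpose_apply, Matrix.of_apply, ite_mul,
    zero_mul]
  ring

theorem aux_inj {n : ℕ} (b : Matrix (Fin n) (Fin n) ℤ) (x y : Fin n → ℤ)
    (h : (EQmat b)ᵀ *ᵥ x = (EQmat b)ᵀ *ᵥ y) : x = y := by
  have hu : IsUnit (EQmat b)ᵀ.det := by rw [Matrix.det_transpose, aux_det]; exact isUnit_one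
  have := congrArg (fun z => ((EQmat b)ᵀ)⁻¹ *ᵥ z) h
  simpa [Matrix.mulVec_mulVec, Matrix.nonsing_inv_mul _ hu] using this

theorem aux_cox_det {n : ℕ} (b : Matrix (Fin n) (Fin n) ℤ) : IsUnit (Cox b).det := by
  have hu : IsUnit (EQmat b).det := by rw [aux_det]; exact isUnit_one
  rw [← Matrix.isUnit_iff_isUnit_det] at *
  have h2 : IsUnit (EQmat b)ᵀ := by
    rw [Matrix.isUnit_iff_isUnit_det, Matrix.det_transpose, aux_det]; exact isUnit_one
  have h3 : IsUnit (EQmat b)⁻¹ := by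
    rw [Matrix.isUnit_nonsing_inv_iff]; exact hu
  exact (h3.mul h2).neg

/-- the candidate solution -/
noncomputable def auxW {n : ℕ} (b : Matrix (Fin n) (Fin n) ℤ) (k : Fin n) (a p : ℤ) :
    Fin n → ℤ := fun i => euler b (Cox b ^ p *ᵥ Pproj b i) (Cox b ^ a *ᵥ Pproj b k)

theorem auxW_eq {n : ℕ} (b : Matrix (Fin n) (Fin n) ℤ) (k : Fin n) (a p : ℤ) :
    auxW b k a p = (EQmat b)⁻¹ *ᵥ (((Cox b)ᵀ ^ p) *ᵥ
      (EQmat b *ᵥ (Cox b ^ a *ᵥ Pproj b k))) := by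
  ext i
  have : ∀ (M : Matrix (Fin n) (Fin n) ℤ) (z : Fin n → ℤ),
      (M *ᵥ Pi.single i 1) ⬝ᵥ z = (Mᵀ *ᵥ z) i := by
    intro M z
    simp [Matrix.mulVec, dotProduct, Matrix.transpose_apply, Pi.single_apply]
  unfold auxW euler
  conv_lhs => arg 1; rw [Pproj, Matrix.mulVec_mulVec]
  rw [this, Matrix.transpose_mul, Matrix.transpose_nonsing_inv, Matrix.transpose_transpose,
    ← Matrix.transpose_zpow]
  simp only [Matrix.mulVec_mulVec, mul_assoc]

theorem aux_key {n : ℕ} (b : Matrix (Fin n) (Fin n) ℤ) :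
    (EQmat b)ᵀ * (EQmat b)⁻¹ * (Cox b)ᵀ = -1 := by
  have hu : IsUnit (EQmat b).det := by rw [aux_det]; exact isUnit_one
  have hu' : IsUnit (EQmat b)ᵀ.det := by rw [Matrix.det_transpose, aux_det]; exact isUnit_one
  have : (Cox b)ᵀ = -(EQmat b * ((EQmat b)ᵀ)⁻¹) := by
    simp [Cox, Matrix.transpose_nonsing_inv]
  rw [this, mul_neg, mul_assoc, Matrix.nonsing_inv_mul_cancel_left _ _ hu,
    Matrix.mul_nonsing_inv _ hu']

theorem aux_W_rec {n : ℕ} (b : Matrix (Fin n) (Fin n) ℤ) (k : Fin n) (a p : ℤ) :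
    (EQmat b)ᵀ *ᵥ auxW b k a p + EQmat b *ᵥ auxW b k a (p - 1) = 0 := by
  have hu : IsUnit (EQmat b).det := by rw [aux_det]; exact isUnit_one
  have hc : IsUnit (Cox b)ᵀ.det := by rw [Matrix.det_transpose]; exact aux_cox_det b
  have e : (Cox b)ᵀ ^ p = (Cox b)ᵀ * (Cox b)ᵀ ^ (p - 1) := by
    rw [← Matrix.zpow_one_add hc]; congr 1; ring
  rw [auxW_eq, auxW_eq, e]
  generalize (EQmat b *ᵥ (Cox b ^ a *ᵥ Pproj b k)) = z
  rw [Matrix.mulVec_mulVec, Matrix.mulVec_mulVec, Matrix.mulVec_mulVec, Matrix.mulVec_mulVec,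
    ← mul_assoc, aux_key, Matrix.mul_nonsing_inv _ hu,
    ← Matrix.add_mulVec]
  simp

theorem aux_inv {n : ℕ} (b : Matrix (Fin n) (Fin n) ℤ) :
    (Cox b)ᵀ * EQmat b * Cox b = EQmat b := by
  have hu : IsUnit (EQmat b).det := by rw [aux_det]; exact isUnit_one
  have hu' : IsUnit (EQmat b)ᵀ.det := by rw [Matrix.det_transpose, aux_det]; exact isUnit_one
  have : (Cox b)ᵀ = -(EQmat b * ((EQmat b)ᵀ)⁻¹) := by
    simp [Cox, Matrix.transpose_nonsing_inv]
  rw [this, Cox]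
  simp only [neg_mul, mul_neg, neg_neg, mul_assoc]
  rw [Matrix.mul_nonsing_inv_cancel_left _ _ hu, Matrix.nonsing_inv_mul _ hu', mul_one]

theorem aux_inv_zpow {n : ℕ} (b : Matrix (Fin n) (Fin n) ℤ) (a : ℤ) :
    (Cox b)ᵀ ^ a * EQmat b * Cox b ^ a = EQmat b := by
  have hc := aux_cox_det b
  have hc' : IsUnit (Cox b)ᵀ.det := by rw [Matrix.det_transpose]; exact hc
  have step : ∀ a : ℤ, (Cox b)ᵀ ^ (a + 1) * EQmat b * Cox b ^ (a + 1)
      = (Cox b)ᵀ ^ a * EQmat b * Cox b ^ a := by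
    intro a
    have e : Cox b ^ (a + 1) = Cox b * Cox b ^ a := by
      rw [← Matrix.zpow_one_add hc]; congr 1; ring
    rw [Matrix.zpow_add_one hc', e]
    calc _ = (Cox b)ᵀ ^ a * ((Cox b)ᵀ * EQmat b * Cox b) * Cox b ^ a := by
          simp only [mul_assoc]
      _ = _ := by rw [aux_inv]
  induction a using Int.induction_on with
  | zero => simp
  | succ i ih => rw [step, ih]
  | pred i ih => rw [← step, sub_add_cancel, ih]

theorem aux_W_base {n : ℕ} (b : Matrix (Fin n) (Fin n) ℤ) (k : Fin n) (a : ℤ) :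
    (EQmat b)ᵀ *ᵥ auxW b k a a = Pi.single k 1 := by
  have hu : IsUnit (EQmat b).det := by rw [aux_det]; exact isUnit_one
  have hu' : IsUnit (EQmat b)ᵀ.det := by rw [Matrix.det_transpose, aux_det]; exact isUnit_one
  rw [auxW_eq, Matrix.mulVec_mulVec (Pproj b k), Matrix.mulVec_mulVec (Pproj b k), ← mul_assoc,
    aux_inv_zpow, Matrix.mulVec_mulVec (Pproj b k), Matrix.nonsing_inv_mul _ hu,
    Matrix.one_mulVec, Pproj, Matrix.mulVec_mulVec, Matrix.mul_nonsing_inv _ hu',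
    Matrix.one_mulVec]

/-- for `θ = C_q⁻¹ e_{k,a}`, the value `θ(k', c)` at a half-integer
`c = m + 1/2` equals `⟨Φ^{c−1/2}[P̄_{k'}], Φ^a[P̄_k]⟩` if `c ≥ a + 1/2`, and `0`
if `c < a + 1/2`. -/
theorem cq_inverse_entries_euler (n : ℕ) (hn : 0 < n) (b : Matrix (Fin n) (Fin n) ℤ)
    (hskew : bᵀ = -b) (hsign : ∀ i j : Fin n, i < j → 0 ≤ b i j)
    (k k' : Fin n) (a m : ℤ) (θ : Fin n × ℝ → ℤ)
    (hθ : GQV.memEhalf θ) (hCq : GQV.Cq b θ = GQV.eind k (a : ℝ)) :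
    θ (k', (m : ℝ) + 1 / 2)
      = if a ≤ m then
          GQV.euler b (GQV.Cox b ^ m *ᵥ GQV.Pproj b k')
            (GQV.Cox b ^ a *ᵥ GQV.Pproj b k)
        else 0 := by
  obtain ⟨-, N, hN⟩ := hθ
  set v : ℤ → Fin n → ℤ := fun p i => θ (i, (p : ℝ) + 1 / 2) with hv
  have hrec : ∀ p, (EQmat b)ᵀ *ᵥ v p + EQmat b *ᵥ v (p - 1)
      = if p = a then Pi.single k 1 else 0 := aux_rec b k a θ hCq
  have hlow : ∀ p, p < N → v p = 0 := by
    intro p hp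
    ext i
    apply hN
    have : (p : ℝ) + 1 ≤ N := by exact_mod_cast hp
    linarith
  have hmain : ∀ j : ℕ, v (min N a - 1 + j) =
      if a ≤ min N a - 1 + j then auxW b k a (min N a - 1 + j) else 0 := by
    intro j
    induction j with
    | zero =>
      rw [hlow _ (by push_cast; omega), if_neg (by push_cast; omega)]
    | succ j ih =>
      set p : ℤ := min N a - 1 + ((j + 1 : ℕ) : ℤ) with hp
      have e : min N a - 1 + (j : ℤ) = p - 1 := by rw [hp]; push_cast; ring
      rw [e] at ih
      have h := hrec p
      rw [ih] at h
      apply aux_inj b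
      rcases lt_trichotomy p a with h1 | h1 | h1
      · rw [if_neg (by omega), if_neg (by omega)] at h
        rw [if_neg (by omega)]
        simpa using h
      · rw [if_neg (by omega), if_pos h1] at h
        rw [if_pos h1.ge, h1, aux_W_base, ← h1]
        simpa using h
      · rw [if_pos (by omega), if_neg (by omega)] at h
        rw [if_pos h1.le]
        exact add_right_cancel (h.trans (aux_W_rec b k a p).symm)
  have hfin : v m = if a ≤ m then auxW b k a m else 0 := by
    by_cases hm : m < min N a
    · rw [hlow m (by omega), if_neg (by omega)]
    · have := hmain (m - (min N a - 1)).toNat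
      rwa [show min N a - 1 + ((m - (min N a - 1)).toNat : ℤ) = m by omega] at this
  have h := congrFun hfin k'
  by_cases hm : a ≤ m
  · rw [if_pos hm] at h ⊢; exact h
  · rw [if_neg hm] at h ⊢; exact h
end

section
/- For all finitely supported w¹, w² : I × ℤ → ℤ: 𝒩(w¹,w²) + 2ℰ'(w¹,w²) = ⟨β(w²), β(w¹)⟩ − ⟨β(w¹), β(w²)⟩. In other words, the difference between the quadratic forms 𝒩 and −2ℰ' is the anti-symmetrized Euler form evaluated on (β(w²), β(w¹)). -/
open Matrix GQV

namespace GQV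

def Wv {n : ℕ} (w : Fin n × ℝ → ℤ) (m : ℤ) : Fin n → ℤ := fun i => w (i, (m : ℝ))

noncomputable def Uv {n : ℕ} (u : Fin n × ℝ → ℤ) (m : ℤ) : Fin n → ℤ :=
  fun i => u (i, (m : ℝ) - 1 / 2)

lemma det_EQ {n : ℕ} (b : Matrix (Fin n) (Fin n) ℤ) : (EQmat b).det = 1 := by
  rw [Matrix.det_of_upperTriangular]
  · apply Finset.prod_eq_one
    intro i _
    simp [EQmat, bUpper]
  · intro i j hij
    have hij' : j < i := hij
    simp [EQmat, bUpper, Matrix.one_apply, hij'.ne', hij'.le]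

lemma EQ_inv_mul {n : ℕ} (b : Matrix (Fin n) (Fin n) ℤ) : (EQmat b)⁻¹ * EQmat b = 1 :=
  Matrix.nonsing_inv_mul _ (by simp [det_EQ])

lemma EQ_mul_inv {n : ℕ} (b : Matrix (Fin n) (Fin n) ℤ) : EQmat b * (EQmat b)⁻¹ = 1 :=
  Matrix.mul_nonsing_inv _ (by simp [det_EQ])

lemma det_Cox {n : ℕ} (b : Matrix (Fin n) (Fin n) ℤ) : IsUnit (Cox b).det := by
  have h : IsUnit (Cox b) := by
    unfold Cox
    rw [IsUnit.neg_iff]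
    apply IsUnit.mul
    · rw [Matrix.isUnit_nonsing_inv_iff, Matrix.isUnit_iff_isUnit_det]; simp [det_EQ]
    · rw [Matrix.isUnit_iff_isUnit_det]; simp [det_EQ]
  rwa [Matrix.isUnit_iff_isUnit_det] at h

lemma EQT_dot {n : ℕ} (b : Matrix (Fin n) (Fin n) ℤ) (x y : Fin n → ℤ) :
    ((EQmat b)ᵀ *ᵥ x) ⬝ᵥ y = euler b x y := by
  rw [Matrix.mulVec_transpose, euler, Matrix.dotProduct_mulVec]

lemma EQ_dot {n : ℕ} (b : Matrix (Fin n) (Fin n) ℤ) (x y : Fin n → ℤ) :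
    (EQmat b *ᵥ x) ⬝ᵥ y = euler b y x := by
  rw [euler, dotProduct_comm]

lemma euler_Cox {n : ℕ} (b : Matrix (Fin n) (Fin n) ℤ) (x y : Fin n → ℤ) :
    euler b (Cox b *ᵥ x) (Cox b *ᵥ y) = euler b x y := by
  have h : EQmat b *ᵥ (Cox b *ᵥ y) = - ((EQmat b)ᵀ *ᵥ y) := by
    rw [Matrix.mulVec_mulVec, Cox, mul_neg, ← mul_assoc, EQ_mul_inv, one_mul, Matrix.neg_mulVec]
  have h' : EQmat b *ᵥ (Cox b *ᵥ x) = - ((EQmat b)ᵀ *ᵥ x) := by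
    rw [Matrix.mulVec_mulVec, Cox, mul_neg, ← mul_assoc, EQ_mul_inv, one_mul, Matrix.neg_mulVec]
  rw [euler, h, dotProduct_neg, dotProduct_comm, EQT_dot, euler, h', dotProduct_neg, neg_neg,
    dotProduct_comm, EQT_dot]

lemma euler_Cox_zpow {n : ℕ} (b : Matrix (Fin n) (Fin n) ℤ) (m : ℤ) (x y : Fin n → ℤ) :
    euler b ((Cox b ^ m) *ᵥ x) ((Cox b ^ m) *ᵥ y) = euler b x y := by
  induction m using Int.induction_on generalizing x y with
  | zero => simp
  | succ i ih =>
    rw [Matrix.zpow_add_one (det_Cox b), ← Matrix.mulVec_mulVec, ← Matrix.mulVec_mulVec, ih,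
      euler_Cox]
  | pred i ih =>
    have h : Cox b ^ (-(i : ℤ)) = Cox b * Cox b ^ (-(i : ℤ) - 1) := by
      rw [← Matrix.zpow_one_add (det_Cox b)]; congr 1; ring
    rw [← ih x y, h, ← Matrix.mulVec_mulVec, ← Matrix.mulVec_mulVec, euler_Cox]

lemma Cq_vec {n : ℕ} (b : Matrix (Fin n) (Fin n) ℤ) (u w : Fin n × ℝ → ℤ) (h : Cq b u = w)
    (m : ℤ) : Wv w m = (EQmat b)ᵀ *ᵥ Uv u (m + 1) + EQmat b *ᵥ Uv u m := by
  subst h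
  have e : ((m + 1 : ℤ) : ℝ) - 1 / 2 = (m : ℝ) + 1 / 2 := by push_cast; ring
  funext k
  simp only [Wv, Cq, EQmat, Matrix.transpose_sub, Matrix.transpose_one, Matrix.sub_mulVec,
    Matrix.one_mulVec, Pi.add_apply, Pi.sub_apply, Matrix.mulVec, dotProduct, bUpper,
    Matrix.transpose_apply, Matrix.of_apply, Uv, e, ite_mul, zero_mul]
  ring

lemma dot_eq {n : ℕ} (w u : Fin n × ℝ → ℤ) (hs : SuppInt w) (N : ℤ) (L : ℕ)
    (hN : ∀ m : ℤ, ∀ i, w (i, (m : ℝ)) ≠ 0 → N ≤ m ∧ m < N + L) (d : ℝ) :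
    dotP (shift w d) u
      = ∑ k ∈ Finset.range L, ∑ i, w (i, ((N + k : ℤ) : ℝ)) * u (i, ((N + k : ℤ) : ℝ) - d) := by
  classical
  let f : ℕ × Fin n → Fin n × ℝ := fun q => (q.2, ((N + q.1 : ℤ) : ℝ) - d)
  have hf : Function.Injective f := by
    rintro ⟨k, i⟩ ⟨k', i'⟩ h
    simpa [f, and_comm] using h
  rw [dotP, finsum_eq_sum_of_support_subset (s := (Finset.range L ×ˢ Finset.univ).image f)]
  · rw [Finset.sum_image (fun _ _ _ _ h => hf h), Finset.sum_product]
    simp [f, shift]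
  · rintro ⟨i, a⟩ h
    have h1 : w (i, a + d) ≠ 0 := by
      intro h0
      apply h
      simp [shift, h0]
    obtain ⟨m, hm⟩ := hs _ h1
    simp only at hm
    rw [hm] at h1
    obtain ⟨h2, h3⟩ := hN m i h1
    simp only [Finset.coe_image, Set.mem_image, Finset.mem_coe, Finset.mem_product,
      Finset.mem_range, Finset.mem_univ, and_true]
    refine ⟨((m - N).toNat, i), by simp; omega, ?_⟩
    have : (N + ((m - N).toNat : ℤ)) = m := by omega
    simp only [f, this]
    rw [← hm]; simp

lemma beta_eq {n : ℕ} (b : Matrix (Fin n) (Fin n) ℤ) (w : Fin n × ℝ → ℤ) (N : ℤ) (L : ℕ)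
    (hN : ∀ m : ℤ, ∀ i, w (i, (m : ℝ)) ≠ 0 → N ≤ m ∧ m < N + L) :
    betaMap b w
      = ∑ k ∈ Finset.range L, - ((Cox b ^ (N + k : ℤ)) *ᵥ ((EQmat b)⁻¹ *ᵥ Wv w (N + k))) := by
  classical
  let f : ℕ × Fin n → Fin n × ℤ := fun q => (q.2, (N + q.1 : ℤ))
  have hf : Function.Injective f := by
    rintro ⟨k, i⟩ ⟨k', i'⟩ h
    simpa [f, and_comm] using h
  rw [betaMap, finsum_eq_sum_of_support_subset (s := (Finset.range L ×ˢ Finset.univ).image f)]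
  · rw [Finset.sum_image (fun _ _ _ _ h => hf h), Finset.sum_product]
    apply Finset.sum_congr rfl
    intro k _
    have hW : Wv w (N + k) = ∑ i, Wv w (N + k) i • (Pi.single i 1 : Fin n → ℤ) := by
      funext j
      simp [Finset.sum_apply, Pi.single_apply]
    rw [hW]
    simp only [Matrix.mulVec_sum, Matrix.mulVec_smul, f, Iinj, Matrix.neg_mulVec, smul_neg,
      Finset.sum_neg_distrib, Wv]
  · rintro ⟨i, m⟩ h
    have h1 : w (i, (m : ℝ)) ≠ 0 := by
      intro h0
      apply h
      simp [h0]
    obtain ⟨h2, h3⟩ := hN m i h1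
    simp only [Finset.coe_image, Set.mem_image, Finset.mem_coe, Finset.mem_product,
      Finset.mem_range, Finset.mem_univ, and_true]
    refine ⟨((m - N).toNat, i), by simp; omega, ?_⟩
    have : (N + ((m - N).toNat : ℤ)) = m := by omega
    simp only [f, this]

lemma x_eq {n : ℕ} (b : Matrix (Fin n) (Fin n) ℤ) (w u : Fin n × ℝ → ℤ) (h : Cq b u = w)
    (N : ℤ) (h0 : Uv u N = 0) (L : ℕ) :
    (Cox b ^ (N + L : ℤ)) *ᵥ Uv u (N + L)
      = ∑ k ∈ Finset.range L, - ((Cox b ^ (N + k : ℤ)) *ᵥ ((EQmat b)⁻¹ *ᵥ Wv w (N + k))) := by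
  induction L with
  | zero => simp [h0]
  | succ L ih =>
    have e : (N + ((L + 1 : ℕ) : ℤ)) = (N + L) + 1 := by push_cast; ring
    rw [Finset.sum_range_succ, ← ih, e, Matrix.zpow_add_one (det_Cox b), ← Matrix.mulVec_mulVec]
    have h1 : Cox b *ᵥ Uv u (N + L + 1)
        = Uv u (N + L) - (EQmat b)⁻¹ *ᵥ Wv w (N + L) := by
      rw [Cq_vec b u w h, Matrix.mulVec_add, Matrix.mulVec_mulVec, Matrix.mulVec_mulVec,
        EQ_inv_mul, Cox, Matrix.neg_mulVec, Matrix.one_mulVec]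
      abel
    rw [h1, Matrix.mulVec_sub, sub_eq_add_neg]

lemma telescope {n : ℕ} (b : Matrix (Fin n) (Fin n) ℤ) (w₁ w₂ u₁ u₂ : Fin n × ℝ → ℤ)
    (h₁ : Cq b u₁ = w₁) (h₂ : Cq b u₂ = w₂) (N : ℤ) (h0 : Uv u₁ N = 0) (L : ℕ) :
    ∑ k ∈ Finset.range L, (- (Wv w₁ (N + k) ⬝ᵥ Uv u₂ (N + k))
        - Wv w₁ (N + k) ⬝ᵥ Uv u₂ (N + k + 1)
        + Wv w₂ (N + k) ⬝ᵥ Uv u₁ (N + k) + Wv w₂ (N + k) ⬝ᵥ Uv u₁ (N + k + 1))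
      = euler b (Uv u₂ (N + L)) (Uv u₁ (N + L)) - euler b (Uv u₁ (N + L)) (Uv u₂ (N + L)) := by
  induction L with
  | zero => simp [h0, euler]
  | succ L ih =>
    have e : (N + ((L + 1 : ℕ) : ℤ)) = (N + L) + 1 := by push_cast; ring
    rw [Finset.sum_range_succ, ih, e, Cq_vec b u₁ w₁ h₁, Cq_vec b u₂ w₂ h₂]
    simp only [add_dotProduct, EQT_dot, EQ_dot]
    ring

lemma exists_bound {n : ℕ} (w : Fin n × ℝ → ℤ) (hw : (Function.support w).Finite) :
    ∃ K : ℕ, ∀ m : ℤ, ∀ i, w (i, (m : ℝ)) ≠ 0 → |m| < K := by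
  have hb : BddAbove ((fun p : Fin n × ℝ => |p.2|) '' Function.support w) :=
    (hw.image _).bddAbove
  obtain ⟨C, hC⟩ := hb
  obtain ⟨K, hK⟩ := exists_nat_gt C
  refine ⟨K, fun m i h => ?_⟩
  have h1 : |(m : ℝ)| ≤ C := hC ⟨(i, (m : ℝ)), h, rfl⟩
  have h2 : |(m : ℝ)| < K := lt_of_le_of_lt h1 hK
  exact_mod_cast h2

lemma Uv_zero {n : ℕ} (u : Fin n × ℝ → ℤ) (hu : memEhalf u) :
    ∃ K : ℤ, ∀ m : ℤ, m ≤ K → Uv u m = 0 := by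
  obtain ⟨_, N, hN⟩ := hu
  refine ⟨N, fun m hm => ?_⟩
  funext i
  apply hN
  have : (m : ℝ) ≤ N := by exact_mod_cast hm
  linarith

end GQV

/-- `𝒩(w¹,w²) + 2ℰ'(w¹,w²) = ⟨β(w²), β(w¹)⟩ − ⟨β(w¹), β(w²)⟩` for all
finitely supported `w¹, w² : I × ℤ → ℤ`. Here `u₁ = C_q⁻¹ w¹` and `u₂ = C_q⁻¹ w²`. -/
theorem Ncal_add_two_Ecal (n : ℕ) (hn : 0 < n) (b : Matrix (Fin n) (Fin n) ℤ)
    (hskew : bᵀ = -b) (hsign : ∀ i j : Fin n, i < j → 0 ≤ b i j)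
    (w₁ w₂ : Fin n × ℝ → ℤ)
    (hw₁ : (Function.support w₁).Finite) (hw₁s : GQV.SuppInt w₁)
    (hw₂ : (Function.support w₂).Finite) (hw₂s : GQV.SuppInt w₂)
    (u₁ u₂ : Fin n × ℝ → ℤ)
    (hu₁ : GQV.memEhalf u₁) (hu₂ : GQV.memEhalf u₂)
    (hu₁Cq : GQV.Cq b u₁ = w₁) (hu₂Cq : GQV.Cq b u₂ = w₂) :
    GQV.Ncal w₁ w₂ u₁ u₂ + 2 * GQV.Ecal w₁ w₂ u₁ u₂
      = GQV.euler b (GQV.betaMap b w₂) (GQV.betaMap b w₁)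
        - GQV.euler b (GQV.betaMap b w₁) (GQV.betaMap b w₂) := by
  obtain ⟨K1, hK1⟩ := exists_bound w₁ hw₁
  obtain ⟨K2, hK2⟩ := exists_bound w₂ hw₂
  obtain ⟨M1, hM1⟩ := Uv_zero u₁ hu₁
  obtain ⟨M2, hM2⟩ := Uv_zero u₂ hu₂
  obtain ⟨N, hN1, hN2, hN3, hN4⟩ : ∃ N : ℤ, N ≤ M1 ∧ N ≤ M2 ∧ N ≤ -K1 ∧ N ≤ -K2 :=
    ⟨min (min M1 M2) (min (-K1) (-K2)), by omega, by omega, by omega, by omega⟩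
  obtain ⟨L, hL1, hL2⟩ : ∃ L : ℕ, (K1 : ℤ) ≤ N + L ∧ (K2 : ℤ) ≤ N + L :=
    ⟨(max ((K1 : ℤ) - N) (K2 - N)).toNat, by omega, by omega⟩
  have hb1 : ∀ m : ℤ, ∀ i, w₁ (i, (m : ℝ)) ≠ 0 → N ≤ m ∧ m < N + L := by
    intro m i h
    have := abs_lt.1 (hK1 m i h)
    omega
  have hb2 : ∀ m : ℤ, ∀ i, w₂ (i, (m : ℝ)) ≠ 0 → N ≤ m ∧ m < N + L := by
    intro m i h
    have := abs_lt.1 (hK2 m i h)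
    omega
  have hd : ∀ (w u : Fin n × ℝ → ℤ), SuppInt w →
      (∀ m : ℤ, ∀ i, w (i, (m : ℝ)) ≠ 0 → N ≤ m ∧ m < N + L) →
      dotP (shift w (1 / 2)) u = ∑ k ∈ Finset.range L, Wv w (N + k) ⬝ᵥ Uv u (N + k) := by
    intro w u hs h
    rw [dot_eq w u hs N L h]
    rfl
  have hd' : ∀ (w u : Fin n × ℝ → ℤ), SuppInt w →
      (∀ m : ℤ, ∀ i, w (i, (m : ℝ)) ≠ 0 → N ≤ m ∧ m < N + L) →
      dotP (shift w (-(1 / 2))) u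
        = ∑ k ∈ Finset.range L, Wv w (N + k) ⬝ᵥ Uv u (N + k + 1) := by
    intro w u hs h
    rw [dot_eq w u hs N L h]
    apply Finset.sum_congr rfl
    intro k _
    have e : ((N + k + 1 : ℤ) : ℝ) - 1 / 2 = ((N + k : ℤ) : ℝ) - -(1 / 2) := by
      push_cast; ring
    simp only [Wv, Uv, dotProduct, e]
  have hT := telescope b w₁ w₂ u₁ u₂ hu₁Cq hu₂Cq N (hM1 N hN1) L
  rw [beta_eq b w₁ N L hb1, beta_eq b w₂ N L hb2, ← x_eq b w₁ u₁ hu₁Cq N (hM1 N hN1) L,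
    ← x_eq b w₂ u₂ hu₂Cq N (hM2 N hN2) L, euler_Cox_zpow, euler_Cox_zpow, ← hT]
  simp only [Finset.sum_add_distrib, Finset.sum_sub_distrib, Finset.sum_neg_distrib]
  rw [Ncal, Ecal, hd w₁ u₂ hw₁s hb1, hd w₂ u₁ hw₂s hb2, hd' w₁ u₂ hw₁s hb1, hd' w₂ u₁ hw₂s hb2]
  ring
end
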